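/- Let P be a connected locally finite poset in which every maximal chain has at least three elements, and let l and l' be maximal chains of P that are not connected to each other. If α, β ∈ I(P,R) satisfy α(x,y) = 0 unless x < y with x, y ∈ P_l, and β(u,v) = 0 unless u < v with u, v ∈ P_{l'}, then αβ = 0 in I(P,R). -/

import Mathlib

open Relation

/-- `l ≈ l'` : `l` and `l'` are maximal chains of `P` having two common elements `x < y`. -/
def ChainApprox {P : Type*} [PartialOrder P] (l l' : Set P) : Prop :=
  IsMaxChain (· ≤ ·) l ∧ IsMaxChain (· ≤ ·) l' ∧
    ∃ x y : P, x < y ∧ x ∈ l ∧ x ∈ l' ∧ y ∈ l ∧ y ∈ l'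

/-- Two maximal chains are *connected* if they are related by the equivalence closure of `≈`. -/
def ChainConnected {P : Type*} [PartialOrder P] (l l' : Set P) : Prop :=
  Relation.EqvGen ChainApprox l l'

/-- `P_l`: the set of elements lying on some maximal chain connected to `l`. -/
def chainComponent {P : Type*} [PartialOrder P] (l : Set P) : Set P :=
  {x | ∃ m : Set P, ChainConnected l m ∧ x ∈ m}

/-- A poset is *connected* if any two of its elements are joined by a finite sequence of
comparability relations. -/
def PosetConnected (P : Type*) [PartialOrder P] : Prop :=
  ∀ x y : P, Relation.ReflTransGen (fun a b : P => a ≤ b ∨ b ≤ a) x y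

/-- Every maximal chain of `P` has at least three elements. -/
def MaxChainsBig (P : Type*) [PartialOrder P] : Prop :=
  ∀ c : Set P, IsMaxChain (· ≤ ·) c →
    ∃ x y z : P, x ∈ c ∧ y ∈ c ∧ z ∈ c ∧ x ≠ y ∧ x ≠ z ∧ y ≠ z

/-- Every three-element chain is contained in a maximal chain. -/
lemma exists_isMaxChain_of_lt_lt {P : Type*} [PartialOrder P] {a b c : P}
    (hab : a < b) (hbc : b < c) :
    ∃ m : Set P, IsMaxChain (· ≤ ·) m ∧ a ∈ m ∧ b ∈ m ∧ c ∈ m := by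
  have hchain : IsChain (· ≤ ·) ({a, b, c} : Set P) := by
    rintro x (rfl | rfl | rfl) y (rfl | rfl | rfl) _ <;>
      grind [le_of_lt, lt_trans, le_refl]
  obtain ⟨m, hm, hsub⟩ := hchain.exists_maxChain
  exact ⟨m, hm, hsub (by simp), hsub (by simp), hsub (by simp)⟩

/-- A maximal chain through a non-maximal element `z` has an element above `z`. -/
lemma IsMaxChain.exists_gt_of_lt {P : Type*} [PartialOrder P] {m : Set P}
    (hm : IsMaxChain (· ≤ ·) m) {z y : P} (hz : z ∈ m) (hzy : z < y) : ∃ w ∈ m, z < w := by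
  by_contra! h
  have hle : ∀ w ∈ m, w ≤ y := fun w hw => by
    rcases hm.1.total hw hz with hwz | hzw
    · exact hwz.trans hzy.le
    · exact (hzw.eq_of_not_lt (h w hw)).symm.le.trans hzy.le
  have hins : IsChain (· ≤ ·) (insert y m) := hm.1.insert fun w hw _ => Or.inr (hle w hw)
  have hy : y ∈ m := by
    rw [hm.2 hins (Set.subset_insert y m)]
    exact Set.mem_insert y m
  exact h y hy hzy

/-- A maximal chain through a non-minimal element `z` has an element below `z`. -/
lemma IsMaxChain.exists_lt_of_lt {P : Type*} [PartialOrder P] {m : Set P}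
    (hm : IsMaxChain (· ≤ ·) m) {x z : P} (hz : z ∈ m) (hxz : x < z) : ∃ w ∈ m, w < z :=
  IsMaxChain.exists_gt_of_lt (P := Pᵒᵈ) hm.symm hz hxz

lemma ChainConnected.isMaxChain {P : Type*} [PartialOrder P] {l m : Set P}
    (h : ChainConnected l m) : IsMaxChain (· ≤ ·) l ↔ IsMaxChain (· ≤ ·) m := by
  induction h with
  | rel _ _ h => exact iff_of_true h.1 h.2.1
  | refl => rfl
  | symm _ _ _ ih => exact ih.symm
  | trans _ _ _ _ _ ih₁ ih₂ => exact ih₁.trans ih₂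

lemma chainConnected_of_lt {P : Type*} [PartialOrder P] {m n : Set P}
    (hm : IsMaxChain (· ≤ ·) m) (hn : IsMaxChain (· ≤ ·) n) {x y : P} (hxy : x < y)
    (hxm : x ∈ m) (hym : y ∈ m) (hxn : x ∈ n) (hyn : y ∈ n) : ChainConnected m n :=
  .rel _ _ ⟨hm, hn, x, y, hxy, hxm, hxn, hym, hyn⟩

/-- If `z` lies in `P_l` and in `P_{l'}` and is neither minimal nor maximal, then `l` and `l'`
are connected. -/
lemma chainConnected_of_mem_chainComponent {P : Type*} [PartialOrder P] {l l' : Set P}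
    (hl : IsMaxChain (· ≤ ·) l) (hl' : IsMaxChain (· ≤ ·) l') {x z y : P}
    (hxz : x < z) (hzy : z < y) (hz : z ∈ chainComponent l) (hz' : z ∈ chainComponent l') :
    ChainConnected l l' := by
  obtain ⟨m, hlm, hzm⟩ := hz
  obtain ⟨m', hlm', hzm'⟩ := hz'
  have hm := hlm.isMaxChain.1 hl
  have hm' := hlm'.isMaxChain.1 hl'
  obtain ⟨w, hwm, hzw⟩ := hm.exists_gt_of_lt hzm hzy
  obtain ⟨v, hvm', hvz⟩ := hm'.exists_lt_of_lt hzm' hxz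
  obtain ⟨n, hn, hvn, hzn, hwn⟩ := exists_isMaxChain_of_lt_lt hvz hzw
  exact (hlm.trans _ _ _ (chainConnected_of_lt hm hn hzw hzm hwm hzn hwn)).trans _ _ _
    ((chainConnected_of_lt hn hm' hvz hvn hzn hvm' hzm').trans _ _ _ (hlm'.symm _ _))

theorem stmt2 {R P : Type*} [CommRing R] [PartialOrder P] [LocallyFiniteOrder P] [DecidableEq P]
    (hP : PosetConnected P) (hbig : MaxChainsBig P)
    (l l' : Set P) (hl : IsMaxChain (· ≤ ·) l) (hl' : IsMaxChain (· ≤ ·) l')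
    (hnc : ¬ ChainConnected l l')
    (α β : IncidenceAlgebra R P)
    (hα : ∀ x y : P, ¬ (x < y ∧ x ∈ chainComponent l ∧ y ∈ chainComponent l) → α x y = 0)
    (hβ : ∀ u v : P, ¬ (u < v ∧ u ∈ chainComponent l' ∧ v ∈ chainComponent l') → β u v = 0) :
    α * β = 0 := by
  ext x y
  rw [IncidenceAlgebra.mul_apply, IncidenceAlgebra.zero_apply]
  refine Finset.sum_eq_zero fun z _ => ?_
  by_cases h : x < z ∧ x ∈ chainComponent l ∧ z ∈ chainComponent l
  · rw [hβ z y fun h' => hnc <|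
      chainConnected_of_mem_chainComponent hl hl' h.1 h'.1 h.2.2 h'.2.1, mul_zero]
  · rw [hα x z h, zero_mul]
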